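/- arXiv:2312.06548 — 2 statements merged into one kernel-verified Lean document; each statement's English description precedes it below -/
import Mathlib

section
/- Let α ∈ (0,1) be irrational and let N be an integer with q_n ≤ N < q_{n+1} and Ostrowski expansion N = Σ_{ℓ=0}^{n} b_ℓ q_ℓ. If 0 ≤ i ≤ n is an index with b_i ≥ 1, then for every t with 0 ≤ t ≤ b_i − 1 one has −λ_i + λ_{i,1} ≤ ε_{i,t}(N) ≤ (a_{i+1} − 1) λ_i + λ_{i,1}. -/
/-- The Gauss map `x ↦ {1/x}`. -/
noncomputable def gaussMap (x : ℝ) : ℝ := Int.fract x⁻¹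

/-- `pq α i` is the `i`-th partial quotient `aᵢ` of the continued fraction
expansion `α = [0; a₁, a₂, …]` of an irrational `α ∈ (0,1)` (meaningful for `i ≥ 1`). -/
noncomputable def pq (α : ℝ) (i : ℕ) : ℕ := ⌊(gaussMap^[i - 1] α)⁻¹⌋₊

/-- `qden α k` is the denominator `q_k` of the `k`-th convergent of `α`:
`q₀ = 1`, `q₁ = a₁`, `q_{k+2} = a_{k+2} q_{k+1} + q_k`. -/
noncomputable def qden (α : ℝ) : ℕ → ℕ
  | 0 => 1
  | 1 => pq α 1
  | (k + 2) => pq α (k + 2) * qden α (k + 1) + qden α k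

/-- Distance to the nearest integer. -/
noncomputable def nint (x : ℝ) : ℝ := |x - round x|

/-- `δ_k = ‖q_k α‖`. -/
noncomputable def dlt (α : ℝ) (k : ℕ) : ℝ := nint (qden α k * α)

/-- `ε_{i,t}(N) = q_i (t δ_i + Σ_{j=1}^{n-i} (-1)^j b_{i+j} δ_{i+j})`,
where `b` are the Ostrowski digits of `N` with top index `n`. -/
noncomputable def eps (α : ℝ) (b : ℕ → ℕ) (n i t : ℕ) : ℝ :=
  (qden α i : ℝ) *
    (t * dlt α i + ∑ j ∈ Finset.Icc 1 (n - i), (-1 : ℝ) ^ j * b (i + j) * dlt α (i + j))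

/-- The product `x₀ x₁ ⋯ x_k` of the orbit of `α` under the Gauss map; it equals `|q_k α - p_k|`. -/
noncomputable def gaussProd (α : ℝ) (k : ℕ) : ℝ := ∏ i ∈ Finset.range (k + 1), gaussMap^[i] α

theorem gaussMap_iterate_mem {α : ℝ} (h0 : 0 < α) (h1 : α < 1) (hirr : Irrational α) (k : ℕ) :
    0 < gaussMap^[k] α ∧ gaussMap^[k] α < 1 ∧ Irrational (gaussMap^[k] α) := by
  induction k with
  | zero => exact ⟨h0, h1, hirr⟩
  | succ k ih =>
    rw [Function.iterate_succ_apply']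
    have hi : Irrational (gaussMap (gaussMap^[k] α)) := by
      unfold gaussMap Int.fract
      exact ih.2.2.inv.sub_intCast _
    exact ⟨lt_of_le_of_ne (Int.fract_nonneg _) hi.ne_zero.symm, Int.fract_lt_one _, hi⟩

theorem pq_succ_mul_iterate {α : ℝ} (h0 : 0 < α) (h1 : α < 1) (hirr : Irrational α) (k : ℕ) :
    (pq α (k + 1) : ℝ) * gaussMap^[k] α + gaussMap^[k] α * gaussMap^[k + 1] α = 1 := by
  have hx := (gaussMap_iterate_mem h0 h1 hirr k).1
  rw [Function.iterate_succ_apply', pq, Nat.add_sub_cancel]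
  have hf : gaussMap (gaussMap^[k] α) = (gaussMap^[k] α)⁻¹ - (⌊(gaussMap^[k] α)⁻¹⌋₊ : ℝ) := by
    rw [natCast_floor_eq_intCast_floor (inv_nonneg.2 hx.le)]
    rfl
  rw [hf]
  field_simp
  ring

theorem pq_succ_pos {α : ℝ} (h0 : 0 < α) (h1 : α < 1) (hirr : Irrational α) (k : ℕ) :
    1 ≤ pq α (k + 1) := by
  obtain ⟨hx, hx1, -⟩ := gaussMap_iterate_mem h0 h1 hirr k
  rw [pq, Nat.add_sub_cancel]
  exact Nat.le_floor (by simpa using (one_le_inv₀ hx).2 hx1.le)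

theorem gaussProd_pos {α : ℝ} (h0 : 0 < α) (h1 : α < 1) (hirr : Irrational α) (k : ℕ) :
    0 < gaussProd α k :=
  Finset.prod_pos fun i _ => (gaussMap_iterate_mem h0 h1 hirr i).1

theorem gaussProd_zero (α : ℝ) : gaussProd α 0 = α := by
  simp [gaussProd]

theorem gaussProd_succ (α : ℝ) (k : ℕ) :
    gaussProd α (k + 1) = gaussProd α k * gaussMap^[k + 1] α :=
  Finset.prod_range_succ _ _

theorem gaussProd_strictAnti {α : ℝ} (h0 : 0 < α) (h1 : α < 1) (hirr : Irrational α) :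
    StrictAnti (gaussProd α) := by
  refine strictAnti_nat_of_succ_lt fun k => ?_
  rw [gaussProd_succ]
  exact mul_lt_of_lt_one_right (gaussProd_pos h0 h1 hirr k)
    (gaussMap_iterate_mem h0 h1 hirr (k + 1)).2.1

theorem pq_one_mul_add_gaussProd_one {α : ℝ} (h0 : 0 < α) (h1 : α < 1) (hirr : Irrational α) :
    (pq α 1 : ℝ) * α + gaussProd α 1 = 1 := by
  have h := pq_succ_mul_iterate h0 h1 hirr 0
  rw [gaussProd_succ, gaussProd_zero]
  simpa using h

theorem gaussProd_recurrence {α : ℝ} (h0 : 0 < α) (h1 : α < 1) (hirr : Irrational α) (k : ℕ) :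
    gaussProd α k = pq α (k + 2) * gaussProd α (k + 1) + gaussProd α (k + 2) := by
  have h := pq_succ_mul_iterate h0 h1 hirr (k + 1)
  rw [gaussProd_succ α (k + 1), gaussProd_succ α k]
  linear_combination (-gaussProd α k) * h

theorem exists_qden_mul_eq {α : ℝ} (h0 : 0 < α) (h1 : α < 1) (hirr : Irrational α) (k : ℕ) :
    ∃ p : ℤ, (qden α k : ℝ) * α = p + (-1) ^ k * gaussProd α k := by
  induction k using Nat.twoStepInduction with
  | zero => exact ⟨0, by simp [qden, gaussProd_zero]⟩
  | one =>
    refine ⟨1, ?_⟩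
    have h := pq_one_mul_add_gaussProd_one h0 h1 hirr
    simp only [qden]
    push_cast
    linarith
  | more k ih₀ ih₁ =>
    obtain ⟨p, hp⟩ := ih₀
    obtain ⟨r, hr⟩ := ih₁
    refine ⟨pq α (k + 2) * r + p, ?_⟩
    simp only [qden]
    push_cast
    linear_combination hp + (pq α (k + 2) : ℝ) * hr +
      (-1) ^ k * gaussProd_recurrence h0 h1 hirr k

theorem nint_intCast_add {e : ℝ} (p : ℤ) (he : |e| < 1 / 2) : nint (p + e) = |e| := by
  have hr : round e = 0 :=
    round_eq_zero_iff.2 ⟨by linarith [(abs_lt.1 he).1], (abs_lt.1 he).2⟩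
  simp [nint, round_intCast_add, hr]

theorem dlt_eq_gaussProd {α : ℝ} (h0 : 0 < α) (h1 : α < 1) (hirr : Irrational α) {k : ℕ}
    (hk : gaussProd α k < 1 / 2) : dlt α k = gaussProd α k := by
  obtain ⟨p, hp⟩ := exists_qden_mul_eq h0 h1 hirr k
  have habs : |(-1) ^ k * gaussProd α k| = gaussProd α k := by
    simp [abs_mul, abs_of_pos (gaussProd_pos h0 h1 hirr k)]
  rw [dlt, hp, nint_intCast_add p (habs.symm ▸ hk), habs]

theorem gaussProd_succ_lt_half {α : ℝ} (h0 : 0 < α) (h1 : α < 1) (hirr : Irrational α) (k : ℕ) :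
    gaussProd α (k + 1) < 1 / 2 := by
  have hanti := gaussProd_strictAnti h0 h1 hirr
  have h10 : gaussProd α 1 < α := by simpa [gaussProd_zero] using hanti zero_lt_one
  have hk : gaussProd α (k + 1) ≤ gaussProd α 1 := hanti.antitone (Nat.le_add_left 1 k)
  have ha : (1 : ℝ) ≤ pq α 1 := by exact_mod_cast pq_succ_pos h0 h1 hirr 0
  nlinarith [pq_one_mul_add_gaussProd_one h0 h1 hirr]

theorem gaussProd_zero_lt_half {α : ℝ} (h0 : 0 < α) (h1 : α < 1) (hirr : Irrational α)
    (ha : 2 ≤ pq α 1) : gaussProd α 0 < 1 / 2 := by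
  have ha' : (2 : ℝ) ≤ pq α 1 := by exact_mod_cast ha
  rw [gaussProd_zero]
  nlinarith [pq_one_mul_add_gaussProd_one h0 h1 hirr, gaussProd_pos h0 h1 hirr 1]

theorem alternating_sum_succ (b : ℕ → ℕ) (D : ℕ → ℝ) (m k : ℕ) :
    ∑ j ∈ Finset.range (m + 1), (-1 : ℝ) ^ j * b (k + j) * D (k + j) =
      b k * D k - ∑ j ∈ Finset.range m, (-1 : ℝ) ^ j * b (k + 1 + j) * D (k + 1 + j) := by
  rw [Finset.sum_range_succ', sub_eq_neg_add, ← Finset.sum_neg_distrib]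
  congr 1
  · refine Finset.sum_congr rfl fun j _ => ?_
    rw [show k + (j + 1) = k + 1 + j by omega]
    ring
  · simp

/-- An alternating sum with digits bounded by the coefficients of a recurrence
`D k = a (k + 2) * D (k + 1) + D (k + 2)` is controlled by its two leading terms. -/
theorem alternating_sum_mem_Icc {D : ℕ → ℝ} {a b : ℕ → ℕ} (hD : ∀ k, 0 ≤ D k)
    (hrec : ∀ k, D k = a (k + 2) * D (k + 1) + D (k + 2)) (m k : ℕ)
    (hb : ∀ l, k + 1 ≤ l → l < k + 1 + m → b l ≤ a (l + 1)) :
    ∑ j ∈ Finset.range m, (-1 : ℝ) ^ j * b (k + 1 + j) * D (k + 1 + j) ∈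
      Set.Icc (-D (k + 1)) (D k) := by
  induction m generalizing k with
  | zero => simp [hD]
  | succ m ih =>
    obtain ⟨hl, hu⟩ := ih (k + 1) fun l h h' => hb l (by omega) (by omega)
    have hba : (b (k + 1) : ℝ) * D (k + 1) ≤ a (k + 2) * D (k + 1) :=
      mul_le_mul_of_nonneg_right (by exact_mod_cast hb (k + 1) le_rfl (by omega)) (hD _)
    have hb0 : 0 ≤ (b (k + 1) : ℝ) * D (k + 1) := mul_nonneg (Nat.cast_nonneg _) (hD _)
    rw [alternating_sum_succ]
    constructor
    · linarith
    · linarith [hrec k]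

/-- Bounds on the perturbations arising in the Ostrowski decomposition:
`-λ_i + λ_{i,1} ≤ ε_{i,t}(N) ≤ (a_{i+1} - 1) λ_i + λ_{i,1}`
where `λ_i = q_i δ_i` and `λ_{i,1} = q_i δ_{i+1}`. -/
theorem eps_bounds
    (α : ℝ) (h0 : 0 < α) (h1 : α < 1) (hirr : Irrational α)
    (n N : ℕ) (b : ℕ → ℕ)
    (hqN : qden α n ≤ N) (hNq : N < qden α (n + 1))
    (hN : N = ∑ ℓ ∈ Finset.range (n + 1), b ℓ * qden α ℓ)
    (hbn : 1 ≤ b n) (hb0 : b 0 < pq α 1)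
    (hb : ∀ ℓ, 1 ≤ ℓ → ℓ ≤ n → b ℓ ≤ pq α (ℓ + 1))
    (hbz : ∀ ℓ, 1 ≤ ℓ → ℓ ≤ n → b ℓ = pq α (ℓ + 1) → b (ℓ - 1) = 0)
    (i : ℕ) (hi : i ≤ n) (hbi : 1 ≤ b i) (t : ℕ) (ht : t ≤ b i - 1) :
    -((qden α i : ℝ) * dlt α i) + (qden α i : ℝ) * dlt α (i + 1) ≤ eps α b n i t ∧
    eps α b n i t ≤
      ((pq α (i + 1) : ℝ) - 1) * ((qden α i : ℝ) * dlt α i) +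
        (qden α i : ℝ) * dlt α (i + 1) := by
  have hanti := gaussProd_strictAnti h0 h1 hirr
  have hrec := gaussProd_recurrence h0 h1 hirr
  have hD k := (gaussProd_pos h0 h1 hirr k).le
  have hdlt (k : ℕ) : dlt α (k + 1) = gaussProd α (k + 1) :=
    dlt_eq_gaussProd h0 h1 hirr (gaussProd_succ_lt_half h0 h1 hirr k)
  have hdlti : dlt α i = gaussProd α i := by
    rcases i with _ | i
    · exact dlt_eq_gaussProd h0 h1 hirr (gaussProd_zero_lt_half h0 h1 hirr (by omega))
    · exact hdlt i
  have hba : b i ≤ pq α (i + 1) := by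
    rcases i with _ | i
    · exact hb0.le
    · exact hb _ (by omega) hi
  have hsum : ∑ j ∈ Finset.Icc 1 (n - i), (-1 : ℝ) ^ j * b (i + j) * dlt α (i + j) =
      -∑ j ∈ Finset.range (n - i),
        (-1 : ℝ) ^ j * b (i + 1 + j) * gaussProd α (i + 1 + j) := by
    rw [← Finset.Ico_succ_right_eq_Icc, Finset.sum_Ico_eq_sum_range, ← Finset.sum_neg_distrib]
    refine Finset.sum_congr (by simp) fun j _ => ?_
    rw [show i + (1 + j) = i + j + 1 by omega, hdlt, show i + 1 + j = i + j + 1 by omega]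
    ring
  have hupper := (alternating_sum_mem_Icc hD hrec (n - i) i
    fun l h h' => hb l (by omega) (by omega)).1
  have hlower : ∑ j ∈ Finset.range (n - i),
      (-1 : ℝ) ^ j * b (i + 1 + j) * gaussProd α (i + 1 + j) ≤
        gaussProd α i - gaussProd α (i + 1) := by
    rcases hm : n - i with _ | m
    · simpa using (hanti (Nat.lt_succ_self i)).le
    · have htail := (alternating_sum_mem_Icc hD hrec m (i + 1)
        fun l h h' => hb l (by omega) (by omega)).1
      have hlt : b (i + 1) + 1 ≤ pq α (i + 2) := by
        refine lt_of_le_of_ne (hb (i + 1) (by omega) (by omega)) fun h => ?_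
        have := hbz (i + 1) (by omega) (by omega) h
        rw [Nat.add_sub_cancel] at this
        omega
      have hlt' : (b (i + 1) + 1 : ℝ) * gaussProd α (i + 1) ≤
          pq α (i + 2) * gaussProd α (i + 1) :=
        mul_le_mul_of_nonneg_right (by exact_mod_cast hlt) (hD _)
      rw [alternating_sum_succ]
      linarith [hrec i]
  have ht' : (t : ℝ) * gaussProd α i ≤ (pq α (i + 1) - 1) * gaussProd α i := by
    refine mul_le_mul_of_nonneg_right ?_ (hD i)
    rw [le_sub_iff_add_le]
    exact_mod_cast (by omega : t + 1 ≤ pq α (i + 1))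
  have ht0 : 0 ≤ (t : ℝ) * gaussProd α i := mul_nonneg (Nat.cast_nonneg _) (hD i)
  have hq : (0 : ℝ) ≤ qden α i := Nat.cast_nonneg _
  rw [eps, hsum, hdlti, hdlt]
  constructor
  · calc -((qden α i : ℝ) * gaussProd α i) + qden α i * gaussProd α (i + 1)
        = qden α i * (-gaussProd α i + gaussProd α (i + 1)) := by ring
      _ ≤ _ := mul_le_mul_of_nonneg_left (by linarith) hq
  · calc _ ≤ (qden α i : ℝ) * ((pq α (i + 1) - 1) * gaussProd α i + gaussProd α (i + 1)) :=
          mul_le_mul_of_nonneg_left (by linarith) hq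
      _ = _ := by ring
end

section
/- For every pattern c = (c_1, …, c_9) ∈ {1,2,3}^9 one has ε_c^min ≥ −λ_c^min, where ε_c^min = −λ_c^max + λ_{c,1}^min − 10^{−100}. -/
/-- `cfval [b₁, …, b_m] t` is the value of the continued fraction
`[0; b₁, …, b_m, tail]` whose tail `[0; tail]` has value `t`, i.e.
`1/(b₁ + 1/(b₂ + ⋯ + 1/(b_m + t)))`. -/
noncomputable def cfval : List ℕ → ℝ → ℝ
  | [], t => t
  | a :: l, t => ((a : ℝ) + cfval l t)⁻¹

/-- The value `[0; \overline{3,1}] = (√21 - 3)/6`. -/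
noncomputable def x31 : ℝ := (Real.sqrt 21 - 3) / 6

/-- The value `[0; \overline{1,3}] = (√21 - 3)/2`. -/
noncomputable def x13 : ℝ := (Real.sqrt 21 - 3) / 2

/-- `c⃗_min = [c₅; c₆, c₇, c₈, c₉, \overline{3,1}]`. -/
noncomputable def vecMin (c : Fin 9 → ℕ) : ℝ := (c 4 : ℝ) + cfval [c 5, c 6, c 7, c 8] x31

/-- `c⃗_max = [c₅; c₆, c₇, c₈, c₉, \overline{1,3}]`. -/
noncomputable def vecMax (c : Fin 9 → ℕ) : ℝ := (c 4 : ℝ) + cfval [c 5, c 6, c 7, c 8] x13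

/-- `⃖c_min = [0; c₄, c₃, c₂, c₁, \overline{3,1}]`. -/
noncomputable def cevMin (c : Fin 9 → ℕ) : ℝ := cfval [c 3, c 2, c 1, c 0] x31

/-- `⃖c_max = [0; c₄, c₃, c₂, c₁, \overline{1,3}]`. -/
noncomputable def cevMax (c : Fin 9 → ℕ) : ℝ := cfval [c 3, c 2, c 1, c 0] x13

/-- `λ_c^min = 1/(c⃗_max + ⃖c_max)`. -/
noncomputable def lamMin (c : Fin 9 → ℕ) : ℝ := (vecMax c + cevMax c)⁻¹

/-- `λ_c^max = 1/(c⃗_min + ⃖c_min)`. -/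
noncomputable def lamMax (c : Fin 9 → ℕ) : ℝ := (vecMin c + cevMin c)⁻¹

/-- `λ_{c,1}^min = (1/(c₅ + ⃖c_max)) · 1/([c₆; c₇, c₈, c₉, \overline{3,1}] + [0; c₅, c₄, c₃, c₂, c₁, \overline{3,1}])`. -/
noncomputable def lam1Min (c : Fin 9 → ℕ) : ℝ :=
  ((c 4 : ℝ) + cevMax c)⁻¹ *
    (((c 5 : ℝ) + cfval [c 6, c 7, c 8] x31) + cfval [c 4, c 3, c 2, c 1, c 0] x31)⁻¹

theorem inv_natCast_add_mem_Icc {a : ℕ} (ha : a ∈ ({1, 2, 3} : Set ℕ)) {s : ℝ}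
    (hs : s ∈ Set.Icc (1 / 4 : ℝ) (4 / 5)) : ((a : ℝ) + s)⁻¹ ∈ Set.Icc (1 / 4 : ℝ) (4 / 5) := by
  obtain ⟨h₁, h₂⟩ := hs
  have ha₁ : (1 : ℝ) ≤ a ∧ (a : ℝ) ≤ 3 := by
    rcases ha with rfl | rfl | rfl <;> norm_num
  have hpos : (0 : ℝ) < a + s := by linarith
  rw [← one_div]
  constructor
  · rw [le_div_iff₀ hpos]; linarith
  · rw [div_le_iff₀ hpos]; linarith

/-- Continued fractions with digits in `{1, 2, 3}` and tail in `[1/4, 4/5]` stay in `[1/4, 4/5]`. -/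
theorem cfval_mem_Icc {l : List ℕ} (hl : ∀ a ∈ l, a ∈ ({1, 2, 3} : Set ℕ)) {t : ℝ}
    (ht : t ∈ Set.Icc (1 / 4 : ℝ) (4 / 5)) : cfval l t ∈ Set.Icc (1 / 4 : ℝ) (4 / 5) := by
  induction l with
  | nil => exact ht
  | cons a l ih =>
    exact inv_natCast_add_mem_Icc (hl a (by simp)) (ih fun b hb => hl b (by simp [hb]))

/-- Prepending two positive digits contracts distances of values `≥ 1/4` by a factor `1/5`. -/
theorem abs_inv_add_inv_add_sub_le {a b s s' : ℝ} (ha : 1 ≤ a) (hb : 1 ≤ b) (hs : 1 / 4 ≤ s)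
    (hs' : 1 / 4 ≤ s') :
    |(a + (b + s)⁻¹)⁻¹ - (a + (b + s')⁻¹)⁻¹| ≤ |s - s'| / 5 := by
  have hbs : 0 < b + s := by linarith
  have hbs' : 0 < b + s' := by linarith
  have h : 9 / 4 ≤ a * (b + s) + 1 := by nlinarith
  have h' : 9 / 4 ≤ a * (b + s') + 1 := by nlinarith
  have key : (a + (b + s)⁻¹)⁻¹ - (a + (b + s')⁻¹)⁻¹
      = (s - s') / ((a * (b + s) + 1) * (a * (b + s') + 1)) := by
    have h₀ : a * (b + s) + 1 ≠ 0 := by linarith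
    have h₀' : a * (b + s') + 1 ≠ 0 := by linarith
    have e : (a + (b + s)⁻¹)⁻¹ = (b + s) / (a * (b + s) + 1) := by
      rw [← inv_div]; congr 1; field_simp
    have e' : (a + (b + s')⁻¹)⁻¹ = (b + s') / (a * (b + s') + 1) := by
      rw [← inv_div]; congr 1; field_simp
    rw [e, e', div_sub_div _ _ h₀ h₀']
    congr 1
    ring
  have hprod : 5 ≤ (a * (b + s) + 1) * (a * (b + s') + 1) := by nlinarith
  rw [key, abs_div, abs_of_pos (by linarith : 0 < (a * (b + s) + 1) * (a * (b + s') + 1))]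
  gcongr

theorem abs_cfval_sub_cfval_le {a b d e : ℕ} (ha : a ∈ ({1, 2, 3} : Set ℕ))
    (hb : b ∈ ({1, 2, 3} : Set ℕ)) (hd : d ∈ ({1, 2, 3} : Set ℕ)) (he : e ∈ ({1, 2, 3} : Set ℕ))
    {t t' : ℝ} (ht : t ∈ Set.Icc (1 / 4 : ℝ) (4 / 5)) (ht' : t' ∈ Set.Icc (1 / 4 : ℝ) (4 / 5)) :
    |cfval [a, b, d, e] t - cfval [a, b, d, e] t'| ≤ 11 / 500 := by
  have one_le {n : ℕ} (hn : n ∈ ({1, 2, 3} : Set ℕ)) : (1 : ℝ) ≤ n := by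
    rcases hn with rfl | rfl | rfl <;> norm_num
  have hde : ∀ x ∈ [d, e], x ∈ ({1, 2, 3} : Set ℕ) := by
    intro x hx
    simp only [List.mem_cons, List.not_mem_nil, or_false] at hx
    rcases hx with rfl | rfl <;> assumption
  have outer := abs_inv_add_inv_add_sub_le (one_le ha) (one_le hb)
    (cfval_mem_Icc hde ht).1 (cfval_mem_Icc hde ht').1
  have inner := abs_inv_add_inv_add_sub_le (one_le hd) (one_le he) ht.1 ht'.1
  have htt : |t - t'| ≤ 11 / 20 := by
    rw [abs_le]; constructor <;> linarith [ht.1, ht.2, ht'.1, ht'.2]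
  simp only [cfval] at outer ⊢
  linarith

theorem x31_mem_Icc : x31 ∈ Set.Icc (1 / 4 : ℝ) (4 / 5) := by
  have h₁ : (9 / 2 : ℝ) ≤ √21 := Real.le_sqrt_of_sq_le (by norm_num)
  have h₂ : √21 ≤ (23 / 5 : ℝ) := Real.sqrt_le_iff.2 (by norm_num)
  unfold x31
  constructor <;> linarith

theorem x13_mem_Icc : x13 ∈ Set.Icc (1 / 4 : ℝ) (4 / 5) := by
  have h₁ : (9 / 2 : ℝ) ≤ √21 := Real.le_sqrt_of_sq_le (by norm_num)
  have h₂ : √21 ≤ (23 / 5 : ℝ) := Real.sqrt_le_iff.2 (by norm_num)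
  unfold x13
  constructor <;> linarith

/-- For every pattern `c ∈ {1,2,3}⁹`:
`ε_c^min = -λ_c^max + λ_{c,1}^min - 10⁻¹⁰⁰ ≥ -λ_c^min`. -/
theorem epsMin_ge_neg_lamMin
    (c : Fin 9 → ℕ) (hc : ∀ i, c i ∈ ({1, 2, 3} : Set ℕ)) :
    -lamMax c + lam1Min c - ((10 : ℝ) ^ (100 : ℕ))⁻¹ ≥ -lamMin c := by
  have bounds (i : Fin 9) : (1 : ℝ) ≤ c i ∧ (c i : ℝ) ≤ 3 := by
    rcases hc i with h | h | h <;> rw [h] <;> norm_num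
  obtain ⟨l₄, u₄⟩ := bounds 4
  obtain ⟨l₅, u₅⟩ := bounds 5
  have mem {l : List (Fin 9)} {t : ℝ} (ht : t ∈ Set.Icc (1 / 4 : ℝ) (4 / 5)) :
      cfval (l.map c) t ∈ Set.Icc (1 / 4 : ℝ) (4 / 5) :=
    cfval_mem_Icc (by simp only [List.mem_map]; rintro _ ⟨i, -, rfl⟩; exact hc i) ht
  have hv := mem (l := [5, 6, 7, 8]) x31_mem_Icc
  have hV := mem (l := [5, 6, 7, 8]) x13_mem_Icc
  have hw := mem (l := [3, 2, 1, 0]) x31_mem_Icc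
  have hW := mem (l := [3, 2, 1, 0]) x13_mem_Icc
  have hp := mem (l := [6, 7, 8]) x31_mem_Icc
  have hq := mem (l := [4, 3, 2, 1, 0]) x31_mem_Icc
  simp only [List.map_cons, List.map_nil] at hv hV hw hW hp hq
  have dv := (abs_le.1 (abs_cfval_sub_cfval_le (hc 5) (hc 6) (hc 7) (hc 8)
    x13_mem_Icc x31_mem_Icc)).2
  have dw := (abs_le.1 (abs_cfval_sub_cfval_le (hc 3) (hc 2) (hc 1) (hc 0)
    x13_mem_Icc x31_mem_Icc)).2
  have hlam : lamMax c - lamMin c ≤ 1 / 50 := by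
    unfold lamMax lamMin
    have hD : 3 / 2 ≤ vecMin c + cevMin c := by
      unfold vecMin cevMin; linarith [hv.1, hw.1]
    have hD' : 3 / 2 ≤ vecMax c + cevMax c := by
      unfold vecMax cevMax; linarith [hV.1, hW.1]
    have hdiff : vecMax c + cevMax c - (vecMin c + cevMin c) ≤ 11 / 250 := by
      unfold vecMax cevMax vecMin cevMin; linarith
    rw [inv_sub_inv (by linarith) (by linarith), div_le_iff₀ (by nlinarith)]
    nlinarith
  have hlam₁ : 1 / 20 ≤ lam1Min c := by
    have hA : 1 / 4 ≤ ((c 4 : ℝ) + cevMax c)⁻¹ := by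
      unfold cevMax
      rw [← one_div, le_div_iff₀ (by linarith [hW.1])]
      linarith [hW.2]
    have hB : 1 / 5 ≤ (((c 5 : ℝ) + cfval [c 6, c 7, c 8] x31) +
        cfval [c 4, c 3, c 2, c 1, c 0] x31)⁻¹ := by
      rw [← one_div, le_div_iff₀ (by linarith [hp.1, hq.1])]
      linarith [hp.2, hq.2]
    unfold lam1Min
    nlinarith
  have hsmall : ((10 : ℝ) ^ (100 : ℕ))⁻¹ ≤ 1 / 50 := by norm_num
  linarith
end
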